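/- arXiv:1508.03937 — 3 statements merged into one kernel-verified Lean document; each statement's English description precedes it below -/
import Mathlib

section
/- Let (Q, G) be an augmented quandle with augmentation ε : Q → G, and let (q_ω)_{ω∈G\Q} be a complete system of representatives of the G-orbits on Q. Then for each orbit ω, the element ε(q_ω) lies in the stabilizer Stab_G(q_ω) and Stab_G(q_ω) is contained in the centralizer of ε(q_ω), so the coset quandle Q(G, {Stab_G(q_ω)}, {ε(q_ω)}) on ⨿_ω G/Stab_G(q_ω) is defined; and the map sending the coset g·Stab_G(q_ω) in the ω-component to g·q_ω ∈ Q is a well-defined bijection which is a quandle isomorphism, i.e. it carries the coset quandle operation xH_ω ▷ yH_τ = x ε(q_ω) x⁻¹ y H_τ to the operation q ▷ r = ε(q)·r on Q. -/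
/-- Let `(Q, G)` be an augmented quandle and `(q ω)` a complete system of
representatives of the `G`-orbits.  Then `ε (q ω)` lies in the stabilizer of `q ω`, the
stabilizer is contained in the centralizer of `ε (q ω)`, and the map
`g · Stab_G(q ω) ↦ g • q ω` is a well-defined bijection from the coset quandle
`⨿ ω, G ⧸ Stab_G(q ω)` to `Q` carrying the coset quandle operation to `q ▷ r = ε(q)·r`. -/
theorem augmented_quandle_coset_representation {Q G : Type*} [Group G] [MulAction G Q]
    (ε : Q → G)
    (h1 : ∀ q : Q, ε q • q = q)
    (h2 : ∀ (g : G) (q : Q), ε (g • q) = g * ε q * g⁻¹)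
    (q : MulAction.orbitRel.Quotient G Q → Q)
    (hq : ∀ ω, Quotient.mk'' (q ω) = ω) :
    (∀ ω, ε (q ω) ∈ MulAction.stabilizer G (q ω)) ∧
    (∀ ω, MulAction.stabilizer G (q ω) ≤ Subgroup.centralizer {ε (q ω)}) ∧
    ∃ f : ((ω : MulAction.orbitRel.Quotient G Q) × (G ⧸ MulAction.stabilizer G (q ω))) → Q,
      (∀ (ω : MulAction.orbitRel.Quotient G Q) (g : G), f ⟨ω, ↑g⟩ = g • q ω) ∧
      Function.Bijective f ∧
      (∀ (ω τ : MulAction.orbitRel.Quotient G Q) (x y : G),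
        f ⟨τ, ↑(x * ε (q ω) * x⁻¹ * y)⟩ = ε (f ⟨ω, ↑x⟩) • f ⟨τ, ↑y⟩) := by
  refine ⟨fun ω => h1 (q ω), fun ω g hg => ?_,
    fun p => MulAction.ofQuotientStabilizer G (q p.1) p.2, fun ω g => rfl, ⟨?_, ?_⟩, ?_⟩
  · rw [Subgroup.mem_centralizer_singleton_iff]
    have h := h2 g (q ω)
    rw [MulAction.mem_stabilizer_iff.mp hg] at h
    exact (eq_mul_inv_iff_mul_eq.mp h).symm
  · rintro ⟨ω, a⟩ ⟨τ, b⟩ h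
    have mk_eq : ∀ (σ : MulAction.orbitRel.Quotient G Q)
        (c : G ⧸ MulAction.stabilizer G (q σ)),
        (Quotient.mk'' (MulAction.ofQuotientStabilizer G (q σ) c) :
          MulAction.orbitRel.Quotient G Q) = σ := fun σ c =>
      (Quotient.sound' (MulAction.ofQuotientStabilizer_mem_orbit G (q σ) c)).trans (hq σ)
    obtain rfl : ω = τ := by
      rw [← mk_eq ω a, ← mk_eq τ b]
      exact congrArg _ h
    exact congrArg (Sigma.mk ω) (MulAction.injective_ofQuotientStabilizer G (q ω) h)
  · intro r
    obtain ⟨g, hg⟩ : r ∈ MulAction.orbit G (q (Quotient.mk'' r)) :=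
      Quotient.exact' (hq (Quotient.mk'' r)).symm
    exact ⟨⟨Quotient.mk'' r, g⟩, hg⟩
  · intro ω τ x y
    simp only [MulAction.ofQuotientStabilizer_mk, h2, mul_smul]
end

section
/- Let A be an integral domain which is a finitely generated ℤ-algebra, K its field of fractions, L an algebraic field extension of K, and B the integral closure of A in L. Then a prime ideal p of B is maximal if and only if the quotient ring B/p has positive characteristic q (i.e. some prime number q lies in p) and every element of B/p is algebraic over the prime field 𝔽_q; equivalently, if and only if the residue field at p is algebraic over a finite field. -/
theorem Int.isJacobsonRing : IsJacobsonRing ℤ := by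
  rw [isJacobsonRing_iff_prime_eq]
  intro P hP
  rcases eq_or_ne P ⊥ with rfl | hP0
  · refine le_antisymm (fun x hx ↦ ?_) Ideal.le_jacobson
    have h := Int.isUnit_iff.mp (Ideal.mem_jacobson_bot.mp hx x)
    have hx0 : x * x = 0 := by
      have := mul_self_nonneg x
      lia
    simpa using hx0
  · have := hP.isMaximal hP0
    exact Ideal.jacobson_eq_self_of_isMaximal

/-- A field which is integral over a finitely generated `ℤ`-algebra is integral over `ℤ`. -/
theorem isIntegral_int_of_isField_of_isIntegral (A F : Type*) [CommRing A]
    [Algebra.FiniteType ℤ A] [CommRing F] [IsDomain F] [Algebra A F] [Algebra.IsIntegral A F]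
    (hF : IsField F) : Algebra.IsIntegral ℤ F := by
  let m : Ideal A := (⊥ : Ideal F).comap (algebraMap A F)
  have : (⊥ : Ideal F).IsMaximal := by
    let := hF.toField
    exact Ideal.bot_isMaximal
  have hm : m.IsMaximal := Ideal.isMaximal_comap_of_isIntegral_of_isMaximal ⊥
  let := Ideal.Quotient.field m
  have := Int.isJacobsonRing
  have : Module.Finite ℤ (A ⧸ m) := finite_of_finite_type_of_isJacobsonRing ℤ (A ⧸ m)
  let g : A ⧸ m →+* F := Ideal.Quotient.lift m (algebraMap A F) fun a ha ↦ by simpa [m] using ha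
  have hg : g.IsIntegral := by
    refine RingHom.IsIntegral.tower_top (Ideal.Quotient.mk m) g ?_
    rw [Ideal.Quotient.lift_comp_mk]
    exact algebraMap_isIntegral_iff.mpr inferInstance
  have hZ : (algebraMap ℤ (A ⧸ m)).IsIntegral := algebraMap_isIntegral_iff.mpr inferInstance
  rw [← algebraMap_isIntegral_iff]
  have h := hZ.trans _ _ hg
  rwa [Subsingleton.elim (g.comp (algebraMap ℤ (A ⧸ m))) (algebraMap ℤ F)] at h

/-- A field which is integral over `ℤ` has positive characteristic. -/
theorem exists_prime_natCast_eq_zero_of_isIntegral_int (F : Type*) [CommRing F] [IsDomain F]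
    [Algebra.IsIntegral ℤ F] (hF : IsField F) : ∃ q : ℕ, q.Prime ∧ (q : F) = 0 := by
  obtain ⟨q, hq⟩ := CharP.exists F
  rcases CharP.char_is_prime_or_zero F q with hp | rfl
  · exact ⟨q, hp, CharP.cast_eq_zero F q⟩
  · have := CharP.charP_to_charZero F
    exact (Int.not_isField (isField_of_isIntegral_of_isField
      (FaithfulSMul.algebraMap_injective ℤ F) hF)).elim

/-- A domain of prime characteristic `q` which is algebraic over `𝔽_q` is a field. -/
theorem isField_of_forall_exists_map_ne_zero {D : Type*} [CommRing D] [IsDomain D] {q : ℕ}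
    (hq : q.Prime) (hq0 : (q : D) = 0)
    (h : ∀ x : D, ∃ f : Polynomial ℤ,
      Polynomial.map (Int.castRingHom (ZMod q)) f ≠ 0 ∧ Polynomial.aeval x f = 0) :
    IsField D := by
  have : Fact q.Prime := ⟨hq⟩
  have : CharP D q := (CharP.charP_iff_prime_eq_zero hq).mpr hq0
  let : Algebra (ZMod q) D := ZMod.algebra D q
  have : Algebra.IsIntegral (ZMod q) D := by
    refine ⟨fun x ↦ ?_⟩
    obtain ⟨f, hf, hfx⟩ := h x
    refine IsAlgebraic.isIntegral ⟨_, hf, ?_⟩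
    have hc : (algebraMap (ZMod q) D).comp (Int.castRingHom (ZMod q)) = algebraMap ℤ D :=
      Subsingleton.elim _ _
    rwa [Polynomial.aeval_def, Polynomial.eval₂_map, hc]
  exact isField_of_isIntegral_of_isField' (Field.toIsField (ZMod q))


/-- Let `A` be a domain which is a finitely generated `ℤ`-algebra, `K` its
fraction field, `L/K` an algebraic extension and `B` the integral closure of `A` in `L`.
A prime ideal `p` of `B` is maximal iff `B/p` has positive prime characteristic `q`
(some prime `q` lies in `p`) and every element of `B/p` is algebraic over the prime field
`𝔽_q` (i.e. is a root of an integer polynomial whose reduction mod `q` is nonzero). -/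
theorem integralClosure_prime_isMaximal_iff {A : Type*} [CommRing A] [IsDomain A]
    [Algebra.FiniteType ℤ A]
    {K L : Type*} [Field K] [Field L] [Algebra A K] [IsFractionRing A K]
    [Algebra K L] [Algebra A L] [IsScalarTower A K L] [Algebra.IsAlgebraic K L]
    (p : Ideal (integralClosure A L)) [p.IsPrime] :
    p.IsMaximal ↔
      ∃ q : ℕ, q.Prime ∧ (q : integralClosure A L) ∈ p ∧
        ∀ x : (integralClosure A L) ⧸ p,
          ∃ f : Polynomial ℤ,
            Polynomial.map (Int.castRingHom (ZMod q)) f ≠ 0 ∧ Polynomial.aeval x f = 0 := by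
  rw [Ideal.Quotient.maximal_ideal_iff_isField_quotient]
  have hmem (q : ℕ) :
      (q : integralClosure A L) ∈ p ↔ (q : (integralClosure A L) ⧸ p) = 0 := by
    rw [← Ideal.Quotient.eq_zero_iff_mem, map_natCast]
  refine ⟨fun hF ↦ ?_, fun ⟨q, hq, hqp, h⟩ ↦
    isField_of_forall_exists_map_ne_zero hq ((hmem q).mp hqp) h⟩
  have : Algebra.IsIntegral A ((integralClosure A L) ⧸ p) :=
    Algebra.IsIntegral.trans (integralClosure A L)
  have hZ := isIntegral_int_of_isField_of_isIntegral A ((integralClosure A L) ⧸ p) hF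
  obtain ⟨q, hq, hq0⟩ :=
    exists_prime_natCast_eq_zero_of_isIntegral_int ((integralClosure A L) ⧸ p) hF
  refine ⟨q, hq, (hmem q).mpr hq0, fun x ↦ ?_⟩
  obtain ⟨f, hf, hfx⟩ := hZ.isIntegral x
  have : Fact q.Prime := ⟨hq⟩
  exact ⟨f, (hf.map _).ne_zero, hfx⟩
end

section
/- Let A be an integral domain which is a finitely generated ℤ-algebra, K its field of fractions, and L an algebraic field extension of K. For every intermediate field M of L/K which is finite-dimensional over K, let A_M denote the integral closure of A in M, and let A_L denote the integral closure of A in L. Then the map sending a maximal ideal m of A_L to the family (m ∩ A_M)_M, indexed by the finite-dimensional intermediate fields M of L/K, is a bijection from the set of maximal ideals of A_L onto the set of compatible families, i.e. families (m_M)_M where each m_M is a maximal ideal of A_M and m_M ∩ A_{M'} = m_{M'} whenever M' ⊆ M. -/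
/-- The integral closure `A_M` of `A` in an intermediate field `M` of `L/K`, realized as
the subring `A_L ∩ M` of the integral closure `A_L` of `A` in `L`. -/
def closureIn (A : Type*) [CommRing A] {K L : Type*} [Field K] [Field L]
    [Algebra K L] [Algebra A L] (M : IntermediateField K L) :
    Subring (integralClosure A L) :=
  Subring.comap (Subalgebra.val (integralClosure A L)).toRingHom
    M.toSubfield.toSubring

theorem closureIn_mono (A : Type*) [CommRing A] {K L : Type*} [Field K] [Field L]
    [Algebra K L] [Algebra A L] {M M' : IntermediateField K L} (h : M' ≤ M) :
    closureIn A M' ≤ closureIn A M :=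
  fun _ hx => h hx

/-- The ring `A_L` is integral over `A_M`. -/
theorem closureIn_subtype_isIntegral (A : Type*) [CommRing A] {K L : Type*} [Field K] [Field L]
    [Algebra A K] [Algebra K L] [Algebra A L] [IsScalarTower A K L] (M : IntermediateField K L) :
    (closureIn A M).subtype.IsIntegral := by
  have hmem : ∀ a : A, algebraMap A (integralClosure A L) a ∈ closureIn A M := fun a => by
    change algebraMap A L a ∈ M
    rw [IsScalarTower.algebraMap_apply A K L]
    exact M.algebraMap_mem _
  refine RingHom.IsIntegral.tower_top
    ((algebraMap A (integralClosure A L)).codRestrict (closureIn A M) hmem) _ ?_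
  exact (algebraMap_isIntegral_iff (R := A) (A := integralClosure A L)).2 inferInstance

/-- Every element of `A_L` lies in `A_M` for some finite-dimensional `M`. -/
theorem exists_mem_closureIn (A : Type*) [CommRing A] {K L : Type*} [Field K] [Field L]
    [Algebra K L] [Algebra A L] [Algebra.IsAlgebraic K L] (x : integralClosure A L) :
    ∃ M : IntermediateField K L, FiniteDimensional K M ∧ x ∈ closureIn A M :=
  ⟨IntermediateField.adjoin K {(x : L)},
    IntermediateField.adjoin.finiteDimensional (Algebra.IsIntegral.isIntegral (x : L)),
    IntermediateField.mem_adjoin_simple_self K (x : L)⟩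

/-- An ideal of `A_L` is determined by its traces on the rings `A_M`. -/
theorem le_of_comap_closureIn_le {A : Type*} [CommRing A] {K L : Type*} [Field K] [Field L]
    [Algebra K L] [Algebra A L] [Algebra.IsAlgebraic K L] {I J : Ideal (integralClosure A L)}
    (h : ∀ M : IntermediateField K L, FiniteDimensional K M →
      Ideal.comap (closureIn A M).subtype I ≤ Ideal.comap (closureIn A M).subtype J) :
    I ≤ J := by
  intro x hx
  obtain ⟨M, hM, hxM⟩ := exists_mem_closureIn A (K := K) x
  exact h M hM (x := ⟨x, hxM⟩) hx

/-- A compatible family of ideals of the rings `A_M` consists of the traces of an ideal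
of `A_L`. -/
theorem exists_ideal_comap_closureIn_eq {A : Type*} [CommRing A] {K L : Type*} [Field K] [Field L]
    [Algebra K L] [Algebra A L] [Algebra.IsAlgebraic K L]
    (mfam : (M : IntermediateField K L) → FiniteDimensional K M → Ideal (closureIn A M))
    (hcompat : ∀ (M M' : IntermediateField K L) (hM : FiniteDimensional K M)
      (hM' : FiniteDimensional K M'), M' ≤ M → ∀ h2 : closureIn A M' ≤ closureIn A M,
        mfam M' hM' = Ideal.comap (Subring.inclusion h2) (mfam M hM)) :
    ∃ m : Ideal (integralClosure A L),
      ∀ (M : IntermediateField K L) (hM : FiniteDimensional K M),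
        mfam M hM = Ideal.comap (closureIn A M).subtype m := by
  have key : ∀ (M M' : IntermediateField K L) (hM : FiniteDimensional K M)
      (hM' : FiniteDimensional K M') (h : M' ≤ M) (x : integralClosure A L)
      (hx : x ∈ closureIn A M'),
      (⟨x, hx⟩ : closureIn A M') ∈ mfam M' hM' ↔
        (⟨x, closureIn_mono A h hx⟩ : closureIn A M) ∈ mfam M hM := by
    intro M M' hM hM' h x hx
    rw [hcompat M M' hM hM' h (closureIn_mono A h)]
    exact Iff.rfl
  let m : Ideal (integralClosure A L) :=
    { carrier := {x | ∃ (M : IntermediateField K L) (hM : FiniteDimensional K M)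
        (hx : x ∈ closureIn A M), (⟨x, hx⟩ : closureIn A M) ∈ mfam M hM}
      zero_mem' := ⟨⊥, inferInstance, zero_mem _, zero_mem _⟩
      add_mem' := by
        rintro x y ⟨M, hM, hx, hxm⟩ ⟨N, hN, hy, hym⟩
        have hMN : FiniteDimensional K ↥(M ⊔ N) := IntermediateField.finiteDimensional_sup M N
        exact ⟨M ⊔ N, hMN, _, add_mem ((key _ _ hMN hM le_sup_left x hx).1 hxm)
          ((key _ _ hMN hN le_sup_right y hy).1 hym)⟩
      smul_mem' := by
        rintro c x ⟨M, hM, hx, hxm⟩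
        obtain ⟨N, hN, hc⟩ := exists_mem_closureIn A (K := K) c
        have hMN : FiniteDimensional K ↥(M ⊔ N) := IntermediateField.finiteDimensional_sup M N
        exact ⟨M ⊔ N, hMN, _, Ideal.mul_mem_left _
          (⟨c, closureIn_mono A le_sup_right hc⟩ : closureIn A (M ⊔ N))
          ((key _ _ hMN hM le_sup_left x hx).1 hxm)⟩ }
  refine ⟨m, fun M hM => le_antisymm (fun x hx => ⟨M, hM, x.2, hx⟩) ?_⟩
  rintro x ⟨N, hN, hx, hxm⟩
  have hMN : FiniteDimensional K ↥(M ⊔ N) := IntermediateField.finiteDimensional_sup M N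
  exact (key _ _ hMN hM le_sup_left x.1 x.2).2 ((key _ _ hMN hN le_sup_right x.1 hx).1 hxm)

/-- An ideal of `A_L` whose traces on the rings `A_M` are all maximal is maximal. -/
theorem isMaximal_of_comap_closureIn {A : Type*} [CommRing A] {K L : Type*} [Field K] [Field L]
    [Algebra K L] [Algebra A L] [Algebra.IsAlgebraic K L] {m : Ideal (integralClosure A L)}
    (h : ∀ M : IntermediateField K L, FiniteDimensional K M →
      (Ideal.comap (closureIn A M).subtype m).IsMaximal) :
    m.IsMaximal := by
  refine Ideal.isMaximal_iff.2 ⟨fun h1 => ?_, fun J x hmJ hxm hxJ => ?_⟩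
  · exact (h ⊥ inferInstance).ne_top ((Ideal.eq_top_iff_one _).2 h1)
  · obtain ⟨M, hM, hxM⟩ := exists_mem_closureIn A (K := K) x
    obtain ⟨y, i, hi, hyi⟩ := (h M hM).exists_inv (x := ⟨x, hxM⟩) hxm
    have hyi' : (y : integralClosure A L) * x + i = 1 := congrArg Subtype.val hyi
    rw [← hyi']
    exact J.add_mem (J.mul_mem_left _ hxJ) (hmJ hi)

/-- Let `A` be a domain which is a finitely generated `ℤ`-algebra with
fraction field `K`, and `L/K` an algebraic extension.  The map sending a maximal ideal `m`
of `A_L` to the family `(m ∩ A_M)_M`, indexed by the finite-dimensional intermediate fields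
`M` of `L/K`, is a bijection from the maximal ideals of `A_L` onto the compatible families
of maximal ideals of the rings `A_M` (compatible: `m_M ∩ A_{M'} = m_{M'}` for `M' ⊆ M`). -/
theorem maximalIdeals_integralClosure_inverse_limit
    {A K L : Type*} [CommRing A] [IsDomain A] [Algebra.FiniteType ℤ A]
    [Field K] [Field L] [Algebra A K] [IsFractionRing A K]
    [Algebra K L] [Algebra A L] [IsScalarTower A K L] [Algebra.IsAlgebraic K L] :
    -- the restriction of a maximal ideal is a compatible family of maximal ideals
    (∀ m : Ideal (integralClosure A L), m.IsMaximal →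
      (∀ (M : IntermediateField K L), FiniteDimensional K M →
        (Ideal.comap (closureIn A M).subtype m).IsMaximal) ∧
      (∀ (M M' : IntermediateField K L), FiniteDimensional K M → FiniteDimensional K M' →
        M' ≤ M → ∀ h2 : closureIn A M' ≤ closureIn A M,
          Ideal.comap (closureIn A M').subtype m
            = Ideal.comap (Subring.inclusion h2) (Ideal.comap (closureIn A M).subtype m))) ∧
    -- injectivity
    (∀ m m' : Ideal (integralClosure A L), m.IsMaximal → m'.IsMaximal →
      (∀ (M : IntermediateField K L), FiniteDimensional K M →
        Ideal.comap (closureIn A M).subtype m = Ideal.comap (closureIn A M).subtype m') →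
      m = m') ∧
    -- surjectivity onto the compatible families
    (∀ mfam : (M : IntermediateField K L) → FiniteDimensional K M → Ideal (closureIn A M),
      (∀ (M : IntermediateField K L) (hM : FiniteDimensional K M), (mfam M hM).IsMaximal) →
      (∀ (M M' : IntermediateField K L) (hM : FiniteDimensional K M)
          (hM' : FiniteDimensional K M'), M' ≤ M → ∀ h2 : closureIn A M' ≤ closureIn A M,
        mfam M' hM' = Ideal.comap (Subring.inclusion h2) (mfam M hM)) →
      ∃ m : Ideal (integralClosure A L), m.IsMaximal ∧
        ∀ (M : IntermediateField K L) (hM : FiniteDimensional K M),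
          mfam M hM = Ideal.comap (closureIn A M).subtype m) := by
  refine ⟨fun m hm => ⟨fun M _ => ?_, fun _ _ _ _ _ _ => rfl⟩, fun m m' _ _ h => ?_,
    fun mfam hmax hcompat => ?_⟩
  · exact Ideal.isMaximal_comap_of_isIntegral_of_isMaximal' _
      (closureIn_subtype_isIntegral A M) m
  · exact le_antisymm (le_of_comap_closureIn_le fun M hM => (h M hM).le)
      (le_of_comap_closureIn_le fun M hM => (h M hM).ge)
  · obtain ⟨m, hm⟩ := exists_ideal_comap_closureIn_eq mfam hcompat
    exact ⟨m, isMaximal_of_comap_closureIn fun M hM => hm M hM ▸ hmax M hM, hm⟩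
end
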